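/- Let X ∈ S^d have a unique stationary distribution and let Y ∈ S^d satisfy ‖X − Y‖_{1→1} ≤ δ. Then for any t ∈ ℕ and any stationary distribution π_Y ∈ Δ^d of Y, sup_{p∈Δ^d} ‖Y^t p − π_Y‖₁ ≤ 2tδ + 2·D_X(t). -/

import Mathlib

open Finset

noncomputable section

/-- The ℓ¹ norm of a vector in `ℝ^d`. -/
def l1 {d : ℕ} (x : Fin d → ℝ) : ℝ := ∑ i, |x i|

/-- The probability simplex `Δ^d ⊆ ℝ^d`. -/
def simplex (d : ℕ) : Set (Fin d → ℝ) := {x | (∀ i, 0 ≤ x i) ∧ ∑ i, x i = 1}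

/-- The scaled simplex `Δ^d_a := a · Δ^d`. -/
def scaledSimplex (d : ℕ) (a : ℝ) : Set (Fin d → ℝ) := {x | ∃ y ∈ simplex d, x = a • y}

/-- `I = ∪_{α ∈ [alb, aub]} Δ^d_α`, the set of valid controls. -/
def ISet (d : ℕ) (alb aub : ℝ) : Set (Fin d → ℝ) :=
  {u | ∃ α ∈ Set.Icc alb aub, u ∈ scaledSimplex d α}

/-- A column-stochastic matrix: nonnegative entries, every column sums to 1. -/
def IsStochastic {d : ℕ} (M : Matrix (Fin d) (Fin d) ℝ) : Prop :=
  (∀ i j, 0 ≤ M i j) ∧ ∀ j, ∑ i, M i j = 1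

/-- `S^d_a := a · S^d`, scaled column-stochastic matrices. -/
def scaledStochastic (d : ℕ) (a : ℝ) : Set (Matrix (Fin d) (Fin d) ℝ) :=
  {M | ∃ N, IsStochastic N ∧ M = a • N}

/-- `S^d_{≤1} := ∪_{a ∈ [0,1]} a · S^d`. -/
def stochasticLeOne (d : ℕ) : Set (Matrix (Fin d) (Fin d) ℝ) :=
  {M | ∃ a ∈ Set.Icc (0:ℝ) 1, M ∈ scaledStochastic d a}

/-- The `1 → 1` operator norm `‖M‖_{1→1} = sup_{‖x‖₁ = 1} ‖Mx‖₁`. -/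
def norm11 {d : ℕ} (M : Matrix (Fin d) (Fin d) ℝ) : ℝ :=
  sSup ((fun x => l1 (M.mulVec x)) '' {x : Fin d → ℝ | l1 x = 1})

/-- `X` has a unique stationary distribution. -/
def hasUniqueStationary {d : ℕ} (X : Matrix (Fin d) (Fin d) ℝ) : Prop :=
  ∃! π : Fin d → ℝ, π ∈ simplex d ∧ X.mulVec π = π

-- The unique stationary distribution of `X` (junk value `0` if not unique).
open Classical in
def statDist {d : ℕ} (X : Matrix (Fin d) (Fin d) ℝ) : Fin d → ℝ :=
  if h : hasUniqueStationary X then h.exists.choose else 0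

/-- `D_X(t) := sup_{p ∈ Δ^d} ‖X^t p − π‖₁`. -/
def Dmix {d : ℕ} (X : Matrix (Fin d) (Fin d) ℝ) (t : ℕ) : ℝ :=
  sSup ((fun p => l1 ((X ^ t).mulVec p - statDist X)) '' simplex d)

/-- `t_mix(X, ε) := min {t : D_X(t) ≤ ε}`, as an extended natural number
(`⊤` if `X` has no unique stationary distribution or never mixes). -/
def tmix {d : ℕ} (X : Matrix (Fin d) (Fin d) ℝ) (ε : ℝ) : ℕ∞ :=
  sInf ((fun t : ℕ => (t : ℕ∞)) '' {t : ℕ | hasUniqueStationary X ∧ Dmix X t ≤ ε})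

/-- `t_mix(X) ≤ r` (with the convention `t_mix(X) = t_mix(X, 1/4)`), for a real bound `r`. -/
def tmixLE {d : ℕ} (X : Matrix (Fin d) (Fin d) ℝ) (r : ℝ) : Prop :=
  ∃ t : ℕ, (t : ℝ) ≤ r ∧ hasUniqueStationary X ∧ Dmix X t ≤ 1/4

/-- `C(K) := (1 − ‖K‖_{1→1}) · A + B K`. -/
def CK {d : ℕ} (A B K : Matrix (Fin d) (Fin d) ℝ) : Matrix (Fin d) (Fin d) ℝ :=
  (1 - norm11 K) • A + B * K

/-- `λ_{t,i} := γ_{t−i} ∏_{j=1}^{i−1} (1 − γ_{t−j})`. -/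
def lam (γ : ℤ → ℝ) (t i : ℕ) : ℝ :=
  γ ((t : ℤ) - i) * ∏ j ∈ Finset.Ico 1 i, (1 - γ ((t : ℤ) - j))

/-- `λ̄_{t,i} := ∏_{j=1}^{i} (1 − γ_{t−j})`. -/
def lamBar (γ : ℤ → ℝ) (t i : ℕ) : ℝ := ∏ j ∈ Finset.Icc 1 i, (1 - γ ((t : ℤ) - j))

/-- `λ_{t,0} := 1 − ∑_{i=1}^{H} λ_{t,i}`. -/
def lam0 (γ : ℤ → ℝ) (H t : ℕ) : ℝ := 1 - ∑ i ∈ Finset.Icc 1 H, lam γ t i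

/-- The state trajectory of a simplex LDS under a given sequence of controls `u`:
`x_1` is the initial state and
`x_{t+1} = (1−γ_t)[(1−‖u_t‖₁) A x_t + B u_t] + γ_t w_t` for `t ≥ 1`. -/
def traj {d : ℕ} (A B : Matrix (Fin d) (Fin d) ℝ) (γ : ℤ → ℝ) (w : ℤ → Fin d → ℝ)
    (x1 : Fin d → ℝ) (u : ℕ → Fin d → ℝ) : ℕ → Fin d → ℝ
  | 0 => x1
  | 1 => x1
  | t + 2 =>
      (1 - γ ((t : ℤ) + 1)) •
          ((1 - l1 (u (t + 1))) • A.mulVec (traj A B γ w x1 u (t + 1)) +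
            B.mulVec (u (t + 1))) +
        γ ((t : ℤ) + 1) • w ((t : ℤ) + 1)

/-- The state trajectory of a simplex LDS under the linear policy `u_t = K x_t`. -/
def trajK {d : ℕ} (A B : Matrix (Fin d) (Fin d) ℝ) (γ : ℤ → ℝ) (w : ℤ → Fin d → ℝ)
    (x1 : Fin d → ℝ) (K : Matrix (Fin d) (Fin d) ℝ) : ℕ → Fin d → ℝ
  | 0 => x1
  | 1 => x1
  | t + 2 =>
      (1 - γ ((t : ℤ) + 1)) •
          ((1 - l1 (K.mulVec (trajK A B γ w x1 K (t + 1)))) •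
              A.mulVec (trajK A B γ w x1 K (t + 1)) +
            B.mulVec (K.mulVec (trajK A B γ w x1 K (t + 1)))) +
        γ ((t : ℤ) + 1) • w ((t : ℤ) + 1)

/-- The disturbance-action control with parameters `(p, M^{[1:H]})`:
`u_s = λ_{s,0} p + ∑_{j=1}^H λ_{s,j} M^{[j]} w_{s−j}`. -/
def dacCtrl {d : ℕ} (γ : ℤ → ℝ) (w : ℤ → Fin d → ℝ) (H : ℕ) (p : Fin d → ℝ)
    (M : ℕ → Matrix (Fin d) (Fin d) ℝ) (s : ℕ) : Fin d → ℝ :=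
  lam0 γ H s • p + ∑ j ∈ Finset.Icc 1 H, lam γ s j • (M j).mulVec (w ((s : ℤ) - j))

/-- Entropy of a sub-distribution `v ∈ Δ^d_{≤1}`. -/
def Ent (d : ℕ) (v : Fin d → ℝ) : ℝ :=
  (1 - ∑ j, v j) * Real.log (1 / (1 - ∑ j, v j)) + ∑ j, v j * Real.log (1 / v j)

/-- The regularizer `Rgpc(p, M^{[1:H]}) = −Ent(p) − ∑_{h=1}^H ∑_{j=1}^d Ent(M^{[h]}_{·,j})`. -/
def Rgpc (d H : ℕ) (z : (Fin d → ℝ) × (ℕ → Matrix (Fin d) (Fin d) ℝ)) : ℝ :=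
  -Ent d z.1 - ∑ h ∈ Finset.Icc 1 H, ∑ j, Ent d (fun i => z.2 h i j)

/-- The domain `X_{d,H,a,b} := ∪_{a' ∈ [a,b]} Δ^d_{a'} × (S^d_{a'})^H`. -/
def Xgpc (d H : ℕ) (a b : ℝ) : Set ((Fin d → ℝ) × (ℕ → Matrix (Fin d) (Fin d) ℝ)) :=
  {z | ∃ a' ∈ Set.Icc a b, z.1 ∈ scaledSimplex d a' ∧
    ∀ h ∈ Finset.Icc 1 H, z.2 h ∈ scaledStochastic d a'}

/-- Euclidean inner product on the parameter space `ℝ^d × (ℝ^{d×d})^H`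
(only the blocks `1 ≤ h ≤ H` count). -/
def iprod (d H : ℕ) (z y : (Fin d → ℝ) × (ℕ → Matrix (Fin d) (Fin d) ℝ)) : ℝ :=
  ∑ i, z.1 i * y.1 i + ∑ h ∈ Finset.Icc 1 H, ∑ i, ∑ j, z.2 h i j * y.2 h i j

/-- The norm `‖(p, M^{[1:H]})‖_{d,H}` with
`‖(p,M)‖² = ‖p‖₁² + ∑_{h=1}^H ∑_{j=1}^d ‖M^{[h]}_{·,j}‖₁²`. -/
def normdH (d H : ℕ) (z : (Fin d → ℝ) × (ℕ → Matrix (Fin d) (Fin d) ℝ)) : ℝ :=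
  Real.sqrt ((l1 z.1) ^ 2 + ∑ h ∈ Finset.Icc 1 H, ∑ j, (∑ i, |z.2 h i j|) ^ 2)

/-- The counterfactual loss `ℓ_t(p, M^{[1:H]}) = c_t(x_t(p,M^{[1:H]}), u_t(p,M^{[1:H]}))`. -/
def lossGPC {d : ℕ} (A B : Matrix (Fin d) (Fin d) ℝ) (γ : ℤ → ℝ) (w : ℤ → Fin d → ℝ)
    (x1 : Fin d → ℝ) (cst : ℕ → (Fin d → ℝ) → (Fin d → ℝ) → ℝ) (H t : ℕ)
    (z : (Fin d → ℝ) × (ℕ → Matrix (Fin d) (Fin d) ℝ)) : ℝ :=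
  cst t (traj A B γ w x1 (dacCtrl γ w H z.1 z.2) t) (dacCtrl γ w H z.1 z.2 t)

lemma mp_l1_add {d : ℕ} (x y : Fin d → ℝ) : l1 (x + y) ≤ l1 x + l1 y := by
  unfold l1
  rw [← Finset.sum_add_distrib]
  exact Finset.sum_le_sum fun i _ => abs_add_le _ _

lemma mp_l1_sub {d : ℕ} (x y : Fin d → ℝ) : l1 (x - y) = l1 (y - x) := by
  unfold l1
  exact Finset.sum_congr rfl fun i _ => abs_sub_comm _ _

lemma mp_l1_simplex {d : ℕ} {p : Fin d → ℝ} (hp : p ∈ simplex d) : l1 p = 1 := by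
  unfold l1
  rw [← hp.2]
  exact Finset.sum_congr rfl fun i _ => abs_of_nonneg (hp.1 i)

lemma mp_stoch_simplex {d : ℕ} {X : Matrix (Fin d) (Fin d) ℝ} (hX : IsStochastic X)
    {p : Fin d → ℝ} (hp : p ∈ simplex d) : X.mulVec p ∈ simplex d := by
  simp only [simplex, Set.mem_setOf_eq, Matrix.mulVec, dotProduct]
  refine ⟨fun i => Finset.sum_nonneg fun j _ => mul_nonneg (hX.1 i j) (hp.1 j), ?_⟩
  rw [Finset.sum_comm]
  simp only [← Finset.sum_mul, hX.2, one_mul]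
  exact hp.2

lemma mp_pow_simplex {d : ℕ} {X : Matrix (Fin d) (Fin d) ℝ} (hX : IsStochastic X)
    {p : Fin d → ℝ} (hp : p ∈ simplex d) (t : ℕ) : (X ^ t).mulVec p ∈ simplex d := by
  induction t with
  | zero => simpa using hp
  | succ n ih =>
    rw [pow_succ', ← Matrix.mulVec_mulVec]
    exact mp_stoch_simplex hX ih

lemma mp_l1_mulVec_le {d : ℕ} (M : Matrix (Fin d) (Fin d) ℝ) (x : Fin d → ℝ) :
    l1 (M.mulVec x) ≤ ∑ j, (∑ i, |M i j|) * |x j| := by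
  unfold l1
  simp only [Matrix.mulVec, dotProduct, Finset.sum_mul]
  rw [Finset.sum_comm (s := Finset.univ) (t := Finset.univ)
    (f := fun j i => |M i j| * |x j|)]
  refine Finset.sum_le_sum fun i _ => ?_
  refine (Finset.abs_sum_le_sum_abs _ _).trans (le_of_eq ?_)
  exact Finset.sum_congr rfl fun j _ => abs_mul _ _

lemma mp_contract {d : ℕ} {X : Matrix (Fin d) (Fin d) ℝ} (hX : IsStochastic X)
    (x : Fin d → ℝ) : l1 (X.mulVec x) ≤ l1 x := by
  refine (mp_l1_mulVec_le X x).trans (le_of_eq ?_)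
  unfold l1
  refine Finset.sum_congr rfl fun j _ => ?_
  rw [Finset.sum_congr rfl fun i _ => abs_of_nonneg (hX.1 i j), hX.2, one_mul]

lemma mp_norm11 {d : ℕ} (M : Matrix (Fin d) (Fin d) ℝ) {x : Fin d → ℝ} (hx : l1 x = 1) :
    l1 (M.mulVec x) ≤ norm11 M := by
  refine le_csSup ⟨∑ j, ∑ i, |M i j|, ?_⟩ ⟨x, hx, rfl⟩
  rintro _ ⟨y, hy, rfl⟩
  refine (mp_l1_mulVec_le M y).trans (Finset.sum_le_sum fun j _ => ?_)
  have h1 : |y j| ≤ 1 := by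
    have hy' : ∑ i, |y i| = 1 := hy
    rw [← hy']
    exact Finset.single_le_sum (f := fun i => |y i|) (fun i _ => abs_nonneg _)
      (Finset.mem_univ j)
  exact mul_le_of_le_one_right (Finset.sum_nonneg fun i _ => abs_nonneg _) h1

lemma mp_Dmix {d : ℕ} {X : Matrix (Fin d) (Fin d) ℝ} (hX : IsStochastic X) (t : ℕ)
    {p : Fin d → ℝ} (hp : p ∈ simplex d) :
    l1 ((X ^ t).mulVec p - statDist X) ≤ Dmix X t := by
  refine le_csSup ⟨1 + l1 (-statDist X), ?_⟩ ⟨p, hp, rfl⟩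
  rintro _ ⟨q, hq, rfl⟩
  have h := mp_l1_add ((X ^ t).mulVec q) (-statDist X)
  rw [mp_l1_simplex (mp_pow_simplex hX hq t), ← sub_eq_add_neg] at h
  exact h

lemma mp_pow_diff {d : ℕ} {X Y : Matrix (Fin d) (Fin d) ℝ} (hX : IsStochastic X)
    (hY : IsStochastic Y) {δ : ℝ} (hδ : norm11 (X - Y) ≤ δ) {p : Fin d → ℝ}
    (hp : p ∈ simplex d) (t : ℕ) : l1 ((X ^ t).mulVec p - (Y ^ t).mulVec p) ≤ t * δ := by
  induction t with
  | zero => simp [l1]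
  | succ n ih =>
    have e : (X ^ (n + 1)).mulVec p - (Y ^ (n + 1)).mulVec p =
        X.mulVec ((X ^ n).mulVec p - (Y ^ n).mulVec p) + (X - Y).mulVec ((Y ^ n).mulVec p) := by
      rw [pow_succ', pow_succ', ← Matrix.mulVec_mulVec, ← Matrix.mulVec_mulVec,
        Matrix.mulVec_sub, Matrix.sub_mulVec]
      abel
    rw [e]
    have h1 := mp_l1_add (X.mulVec ((X ^ n).mulVec p - (Y ^ n).mulVec p))
      ((X - Y).mulVec ((Y ^ n).mulVec p))
    have h2 := mp_contract hX ((X ^ n).mulVec p - (Y ^ n).mulVec p)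
    have h3 := mp_norm11 (X - Y) (mp_l1_simplex (mp_pow_simplex hY hp n))
    push_cast
    linarith

/-- Perturbation bound for mixing (Lemma on mixing of perturbed chains).  If `X ∈ S^d`
has a unique stationary distribution, `Y ∈ S^d` satisfies `‖X − Y‖_{1→1} ≤ δ`, and
`π_Y` is any stationary distribution of `Y`, then for every `t ∈ ℕ` and every `p ∈ Δ^d`,
`‖Y^t p − π_Y‖₁ ≤ 2tδ + 2·D_X(t)`. -/
theorem mixing_perturbation (d : ℕ) (X Y : Matrix (Fin d) (Fin d) ℝ)
    (hX : IsStochastic X) (hY : IsStochastic Y)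
    (hXuniq : hasUniqueStationary X)
    (δ : ℝ) (hδ : norm11 (X - Y) ≤ δ)
    (πY : Fin d → ℝ) (hπY : πY ∈ simplex d ∧ Y.mulVec πY = πY)
    (t : ℕ) :
    ∀ p ∈ simplex d, l1 ((Y ^ t).mulVec p - πY) ≤ 2 * t * δ + 2 * Dmix X t := by
  intro p hp
  have hfix : (Y ^ t).mulVec πY = πY := by
    induction t with
    | zero => simp
    | succ n ih => rw [pow_succ, ← Matrix.mulVec_mulVec, hπY.2, ih]
  have a1 := mp_pow_diff hX hY hδ hp t
  have a2 := mp_pow_diff hX hY hδ hπY.1 t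
  have b1 := mp_Dmix hX t hp
  have b2 := mp_Dmix hX t hπY.1
  rw [hfix] at a2
  rw [mp_l1_sub] at a1 b2
  have e : (Y ^ t).mulVec p - πY = (((Y ^ t).mulVec p - (X ^ t).mulVec p) +
      ((X ^ t).mulVec p - statDist X)) + ((statDist X - (X ^ t).mulVec πY) +
      ((X ^ t).mulVec πY - πY)) := by abel
  rw [e]
  have c1 := mp_l1_add (((Y ^ t).mulVec p - (X ^ t).mulVec p) +
      ((X ^ t).mulVec p - statDist X)) ((statDist X - (X ^ t).mulVec πY) +
      ((X ^ t).mulVec πY - πY))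
  have c2 := mp_l1_add ((Y ^ t).mulVec p - (X ^ t).mulVec p) ((X ^ t).mulVec p - statDist X)
  have c3 := mp_l1_add (statDist X - (X ^ t).mulVec πY) ((X ^ t).mulVec πY - πY)
  linarith

end
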